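/- There exists an absolute constant c > 0 with the following property. Let f be a force with (c/(α^{5/2} β)) ‖f‖_{H¹_α} ≤ β. Let (u₁, N₁, p₁) and (u₂, N₂, p₂) be classical solutions of the damped Navier–Stokes–Bardina equations with force f and initial data u_{0,1}, u_{0,2}, and assume ‖u_{0,1}‖_{H¹_α} ≤ (√8/β) ‖f‖_{H¹_α}. Then sup_{t ≥ 0} ‖u₁(t,·) − u₂(t,·)‖_{H¹_α} ≤ ‖u_{0,1} − u_{0,2}‖_{H¹_α}; in particular every such initial datum u_{0,1} is orbitally stable. -/

import Mathlib

open MeasureTheory Set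

noncomputable section

abbrev V3 : Type := Fin 3 → ℝ

def pd (j : Fin 3) (g : V3 → Fin 3 → ℝ) : V3 → Fin 3 → ℝ :=
  fun x => fderiv ℝ g x (Pi.single j 1)

def pdS (j : Fin 3) (g : V3 → ℝ) : V3 → ℝ :=
  fun x => fderiv ℝ g x (Pi.single j 1)

def L2sq (g : V3 → Fin 3 → ℝ) : ℝ := ∫ x : V3, ∑ i, (g x i)^2
def H1sq (g : V3 → Fin 3 → ℝ) : ℝ := ∫ x : V3, ∑ i, ∑ j, (pd j g x i)^2
def H2sq (g : V3 → Fin 3 → ℝ) : ℝ := ∫ x : V3, ∑ i, ∑ j, ∑ k, (pd k (pd j g) x i)^2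
def H1aSq (α : ℝ) (g : V3 → Fin 3 → ℝ) : ℝ := L2sq g + α^2 * H1sq g

def IsSchwartz {F : Type*} [NormedAddCommGroup F] [NormedSpace ℝ F] (g : V3 → F) : Prop :=
  ContDiff ℝ (⊤ : ℕ∞) g ∧ ∀ (k n : ℕ), ∃ C : ℝ, ∀ x : V3, ‖x‖ ^ k * ‖iteratedFDeriv ℝ n g x‖ ≤ C

def IsForce (f : V3 → Fin 3 → ℝ) : Prop :=
  IsSchwartz f ∧ ∀ x, (∑ j, pd j f x j) = 0

def SchwartzLocBdd {F : Type*} [NormedAddCommGroup F] [NormedSpace ℝ F]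
    (g : ℝ → V3 → F) : Prop :=
  ContDiffOn ℝ (⊤ : ℕ∞) (fun q : ℝ × V3 => g q.1 q.2) (Set.Ici (0:ℝ) ×ˢ Set.univ) ∧
  ∀ T > (0:ℝ), ∀ (k n : ℕ), ∃ C : ℝ, ∀ t ∈ Set.Icc (0:ℝ) T, ∀ x : V3,
    ‖x‖ ^ k * ‖iteratedFDeriv ℝ n (g t) x‖ ≤ C

structure ClassicalSolution (α β ν : ℝ) (u₀ f : V3 → Fin 3 → ℝ) where
  u : ℝ → V3 → Fin 3 → ℝ
  N : ℝ → V3 → Fin 3 → ℝ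
  p : ℝ → V3 → ℝ
  reg_u : SchwartzLocBdd u
  reg_N : SchwartzLocBdd N
  reg_p : SchwartzLocBdd p
  divFree : ∀ t ≥ (0:ℝ), ∀ x, (∑ j, pd j (u t) x j) = 0
  filter : ∀ t ≥ (0:ℝ), ∀ x i, -α^2 * (∑ j, pd j (pd j (N t)) x i) + N t x i
      = ∑ j, u t x j * pd j (u t) x i
  momentum : ∀ t ≥ (0:ℝ), ∀ x i,
      derivWithin (fun s => u s x i) (Set.Ici (0:ℝ)) t + N t x i
        - ν * (∑ j, pd j (pd j (u t)) x i) + pdS i (p t) x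
      = f x i - β * u t x i
  init : ∀ x, u 0 x = u₀ x

open LineDeriv SchwartzMap
open scoped Topology ContDiff

/-- Real-valued Schwartz functions on `ℝ³`. -/
abbrev S3 : Type := SchwartzMap V3 ℝ

/-- The `j`-th partial derivative on Schwartz functions. -/
def dS (j : Fin 3) : S3 →L[ℝ] S3 := lineDerivOpCLM ℝ S3 (Pi.single j (1 : ℝ) : V3)

/-- Pointwise multiplication of Schwartz functions. -/
def mulS : S3 →ₗ[ℝ] S3 →L[ℝ] S3 := SchwartzMap.pairing (ContinuousLinearMap.mul ℝ ℝ)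

/-- The sum of the second pure partial derivatives. -/
def lapS : S3 →L[ℝ] S3 := ∑ j, dS j ∘L dS j

/-- The Helmholtz operator `1 - α² Δ`. -/
def helmS (α : ℝ) : S3 →L[ℝ] S3 := ContinuousLinearMap.id ℝ S3 - α ^ 2 • lapS

lemma dS_apply (j : Fin 3) (f : S3) (x : V3) : dS j f x = fderiv ℝ f x (Pi.single j 1) := rfl

lemma mulS_apply (f g : S3) (x : V3) : mulS f g x = f x * g x := rfl

lemma mulS_comm (f g : S3) : mulS f g = mulS g f := by
  ext x; simp only [mulS_apply]; ring

lemma mulS_assoc (f g h : S3) : mulS (mulS f g) h = mulS f (mulS g h) := by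
  ext x; simp only [mulS_apply]; ring

lemma lapS_apply (f : S3) : lapS f = ∑ j, dS j (dS j f) := by
  simp [lapS]

lemma helmS_apply (α : ℝ) (f : S3) : helmS α f = f - α ^ 2 • lapS f := by
  simp [helmS]

lemma dS_mulS (j : Fin 3) (f g : S3) :
    dS j (mulS f g) = mulS (dS j f) g + mulS f (dS j g) := by
  ext x
  have h := (f.hasFDerivAt x).mul (g.hasFDerivAt x)
  have h2 : dS j (mulS f g) x = (f x • fderiv ℝ g x + g x • fderiv ℝ f x) (Pi.single j 1) := by
    rw [dS_apply]
    exact congrArg (fun L : V3 →L[ℝ] ℝ => L (Pi.single j 1)) h.fderiv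
  rw [h2]
  simp only [add_apply, mulS_apply, dS_apply, smul_apply, smul_eq_mul]
  ring

lemma dS_comm (i j : Fin 3) (f : S3) : dS i (dS j f) = dS j (dS i f) := by
  ext x
  have key : ∀ a b : Fin 3, dS a (dS b f) x
      = fderiv ℝ (fderiv ℝ f) x (Pi.single a 1) (Pi.single b 1) := by
    intro a b
    rw [dS_apply]
    have hd : DifferentiableAt ℝ (fderiv ℝ f) x :=
      ((f.smooth 2).fderiv_right (m := 1) (by norm_num)).differentiable (by simp) x
    have e : (dS b f : V3 → ℝ) = fun y => fderiv ℝ f y (Pi.single b 1) := rfl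
    rw [e, fderiv_clm_apply hd (differentiableAt_const _)]
    simp
  rw [key, key]
  have hs : IsSymmSndFDerivAt ℝ f x :=
    ((f.smooth 2).contDiffAt).isSymmSndFDerivAt (by simp)
  exact hs.eq _ _

lemma dS_lapS (i : Fin 3) (f : S3) : dS i (lapS f) = lapS (dS i f) := by
  simp only [lapS_apply, map_sum]
  exact Finset.sum_congr rfl fun j _ => by rw [dS_comm i j, dS_comm i j]

/-- The `L²` inner product on Schwartz functions. -/
def inn : S3 →ₗ[ℝ] S3 →ₗ[ℝ] ℝ :=
  LinearMap.mk₂ ℝ (fun f g => SchwartzMap.integralCLM ℝ volume (mulS f g))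
    (by intros; simp [-integralCLM_apply]) (by intros; simp [-integralCLM_apply])
    (by intros; simp [-integralCLM_apply]) (by intros; simp [-integralCLM_apply])

lemma inn_eq_integral_mulS (f g : S3) : inn f g = ∫ x, mulS f g x := rfl

lemma inn_eq (f g : S3) : inn f g = ∫ x, f x * g x := rfl

lemma inn_comm (f g : S3) : inn f g = inn g f := by
  simp only [inn_eq_integral_mulS, mulS_comm f g]

lemma inn_self_nonneg (f : S3) : 0 ≤ inn f f :=
  integral_nonneg fun _ => mul_self_nonneg _

lemma inn_mulS_left (f g h : S3) : inn (mulS f g) h = inn f (mulS g h) := by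
  simp only [inn_eq_integral_mulS, mulS_assoc]

lemma inn_dS_right (j : Fin 3) (f g : S3) : inn f (dS j g) = - inn (dS j f) g :=
  integral_mul_lineDerivOp_right_eq_neg_left f g _

lemma inn_lapS_right (f g : S3) : inn f (lapS g) = - ∑ j, inn (dS j f) (dS j g) := by
  simp only [lapS_apply, map_sum, inn_dS_right, Finset.sum_neg_distrib]

lemma inn_lapS_comm (f g : S3) : inn f (lapS g) = inn (lapS f) g := by
  rw [inn_comm (lapS f) g, inn_lapS_right, inn_lapS_right]
  simp only [inn_comm]

lemma inn_helmS_comm (α : ℝ) (f g : S3) : inn f (helmS α g) = inn (helmS α f) g := by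
  simp only [helmS_apply, map_sub, map_smul, LinearMap.sub_apply, LinearMap.smul_apply,
    inn_lapS_comm]

lemma inn_helmS (α : ℝ) (f g : S3) :
    inn f (helmS α g) = inn f g + α ^ 2 * ∑ j, inn (dS j f) (dS j g) := by
  simp only [helmS_apply, map_sub, map_smul, inn_lapS_right, smul_eq_mul]
  ring

lemma inn_helmS_symm (α : ℝ) (f g : S3) : inn f (helmS α g) = inn g (helmS α f) := by
  rw [inn_helmS_comm, inn_comm]

lemma inn_helmS_self_nonneg (α : ℝ) (f : S3) : 0 ≤ inn f (helmS α f) := by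
  rw [inn_helmS]
  exact add_nonneg (inn_self_nonneg f)
    (mul_nonneg (sq_nonneg α) (Finset.sum_nonneg fun j _ => inn_self_nonneg (dS j f)))

lemma inn_sq_le (f g : S3) : inn f g ^ 2 ≤ inn f f * inn g g := by
  have := LinearMap.BilinForm.apply_mul_apply_le_of_forall_zero_le inn inn_self_nonneg f g
  rwa [inn_comm g f, ← sq] at this

/-- The squared `H¹_α` norm of a Schwartz vector field. -/
def energy (α : ℝ) (w : Fin 3 → S3) : ℝ := ∑ i, inn (w i) (helmS α (w i))

lemma energy_nonneg (α : ℝ) (w : Fin 3 → S3) : 0 ≤ energy α w :=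
  Finset.sum_nonneg fun _ _ => inn_helmS_self_nonneg _ _

lemma inn_helmS_le_energy (α : ℝ) (w : Fin 3 → S3) (i : Fin 3) :
    inn (w i) (helmS α (w i)) ≤ energy α w :=
  Finset.single_le_sum (f := fun i => inn (w i) (helmS α (w i)))
    (fun _ _ => inn_helmS_self_nonneg _ _) (Finset.mem_univ i)

/-- The convective term `(b · ∇) w`. -/
def conv (b w : Fin 3 → S3) (i : Fin 3) : S3 := ∑ j, mulS (b j) (dS j (w i))

lemma sum_inn_conv_self {b : Fin 3 → S3} (hb : ∑ j, dS j (b j) = 0) (w : Fin 3 → S3) :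
    ∑ i, inn (conv b w i) (w i) = 0 := by
  refine Finset.sum_eq_zero fun i _ => ?_
  have h : ∀ j, inn (mulS (b j) (dS j (w i))) (w i)
      = - inn (mulS (b j) (dS j (w i))) (w i) - inn (mulS (dS j (b j)) (w i)) (w i) := by
    intro j
    have h1 : inn (mulS (b j) (dS j (w i))) (w i) = inn (mulS (b j) (w i)) (dS j (w i)) := by
      rw [inn_mulS_left, inn_mulS_left, mulS_comm (dS j (w i))]
    conv_lhs => rw [h1, inn_dS_right, dS_mulS]
    simp only [map_add, LinearMap.add_apply]
    ring
  have h2 : ∑ j, inn (mulS (dS j (b j)) (w i)) (w i) = 0 := by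
    have := congrArg (fun g => inn (mulS g (w i)) (w i)) hb
    simpa using this
  have h3 : ∑ j, inn (mulS (b j) (dS j (w i))) (w i) = inn (conv b w i) (w i) := by
    simp [conv]
  have h4 := Finset.sum_congr rfl fun j (_ : j ∈ Finset.univ) => h j
  rw [Finset.sum_sub_distrib, Finset.sum_neg_distrib, h2, h3] at h4
  linarith

/-- The right-hand side of the evolution equation, solved for the time derivative. -/
def evol (β ν : ℝ) (w n F : Fin 3 → S3) (p : S3) (i : Fin 3) : S3 :=
  -n i + ν • lapS (w i) - dS i p + F i - β • w i

lemma sum_inn_dS_eq_zero {w : Fin 3 → S3} (hw : ∑ j, dS j (w j) = 0) (p : S3) :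
    ∑ i, inn (dS i p) (w i) = 0 := by
  have : ∀ i, inn (dS i p) (w i) = - inn p (dS i (w i)) := fun i => by
    rw [inn_dS_right, neg_neg]
  simp only [this, Finset.sum_neg_distrib]
  rw [← map_sum, hw, map_zero, neg_zero]

lemma sum_inn_evol_le {α β ν : ℝ} (hν : 0 ≤ ν) {w n F R : Fin 3 → S3} {p : S3}
    (hw : ∑ j, dS j (w j) = 0) (hn : ∀ i, helmS α (n i) = R i) :
    ∑ i, inn (evol β ν w n F p i) (helmS α (w i))
      ≤ - ∑ i, inn (R i) (w i) + ∑ i, inn (F i) (helmS α (w i)) - β * energy α w := by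
  have hdiv : ∑ j, dS j (helmS α (w j)) = 0 := by
    have : ∑ j, dS j (helmS α (w j)) = helmS α (∑ j, dS j (w j)) := by
      rw [map_sum]
      refine Finset.sum_congr rfl fun j _ => ?_
      simp only [helmS_apply, map_sub, map_smul, dS_lapS]
    rw [this, hw, map_zero]
  have hp := sum_inn_dS_eq_zero hdiv p
  have hterm : ∀ i, inn (evol β ν w n F p i) (helmS α (w i))
      = - inn (R i) (w i) + ν * inn (lapS (w i)) (helmS α (w i))
        - inn (dS i p) (helmS α (w i)) + inn (F i) (helmS α (w i))
        - β * inn (w i) (helmS α (w i)) := by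
    intro i
    rw [← hn i, ← inn_helmS_comm]
    simp only [evol, map_add, map_sub, map_neg, map_smul, LinearMap.add_apply,
      LinearMap.sub_apply, LinearMap.neg_apply, LinearMap.smul_apply, smul_eq_mul]
  have hvisc : ∀ i, inn (lapS (w i)) (helmS α (w i)) ≤ 0 := by
    intro i
    rw [helmS_apply, map_sub, map_smul, smul_eq_mul, inn_comm _ (w i), inn_lapS_right]
    have h1 := Finset.sum_nonneg fun j (_ : j ∈ Finset.univ) => inn_self_nonneg (dS j (w i))
    have h2 := mul_nonneg (sq_nonneg α) (inn_self_nonneg (lapS (w i)))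
    linarith
  have hv := mul_nonpos_of_nonneg_of_nonpos hν
    (Finset.sum_nonpos fun i (_ : i ∈ Finset.univ) => hvisc i)
  rw [Finset.mul_sum] at hv
  simp only [hterm, Finset.sum_add_distrib, Finset.sum_sub_distrib, Finset.sum_neg_distrib,
    ← Finset.mul_sum, hp, energy] at hv ⊢
  linarith

/-- The Sobolev inequality `Ḣ¹ ⊆ L⁶` in integrated form, for compactly supported functions. -/
lemma exists_integral_pow_six_le : ∃ C : ℝ, 0 ≤ C ∧ ∀ h : S3, HasCompactSupport h →
    ∫ x, h x ^ 6 ≤ C * (∫ x, ‖fderiv ℝ h x‖ ^ 2) ^ 3 := by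
  set C := SNormLESNormFDerivOfEqConst ℝ (volume : Measure V3) ((2 : NNReal) : ℝ)
  refine ⟨(C : ℝ) ^ 6, by positivity, fun h hc => ?_⟩
  have key : eLpNorm h ((6 : NNReal) : ENNReal) volume
      ≤ (C : ENNReal) * eLpNorm (fderiv ℝ h) ((2 : NNReal) : ENNReal) volume := eLpNorm_le_eLpNorm_fderiv_of_eq (volume : Measure V3) (p := 2) (p' := 6)
    ((h.smooth 1)) hc (by norm_num) (by simp) (by simp; norm_num)
  have h6 : MemLp h ((6 : NNReal) : ENNReal) volume := h.memLp _
  have h2 : MemLp (fderiv ℝ h) ((2 : NNReal) : ENNReal) volume :=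
    (SchwartzMap.fderivCLM ℝ V3 ℝ h).memLp ((2 : NNReal) : ENNReal) volume
  rw [h6.eLpNorm_eq_integral_rpow_norm (by simp) (by simp),
    h2.eLpNorm_eq_integral_rpow_norm (by simp) (by simp), ← ENNReal.ofReal_coe_nnreal (p := C),
    ← ENNReal.ofReal_mul (by positivity), ENNReal.ofReal_le_ofReal_iff (by positivity)] at key
  have e6 : ((6 : NNReal) : ENNReal).toReal = 6 := by simp
  have e2 : ((2 : NNReal) : ENNReal).toReal = 2 := by simp
  rw [e6, e2] at key
  have i6 : ∫ x, ‖h x‖ ^ (6 : ℝ) = ∫ x, h x ^ 6 := by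
    refine integral_congr_ae (.of_forall fun x => ?_)
    have : ‖h x‖ ^ (6 : ℝ) = ‖h x‖ ^ (6 : ℕ) := by exact_mod_cast Real.rpow_natCast ‖h x‖ 6
    change ‖h x‖ ^ (6 : ℝ) = h x ^ 6
    rw [this, Real.norm_eq_abs]
    exact Even.pow_abs (by decide : Even 6) _
  have i2 : ∫ x, ‖fderiv ℝ h x‖ ^ (2 : ℝ) = ∫ x, ‖fderiv ℝ h x‖ ^ 2 := by
    simp
  rw [i6, i2] at key
  have p6 : 0 ≤ ∫ x, h x ^ 6 := integral_nonneg fun x => by positivity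
  have p2 : 0 ≤ ∫ x, ‖fderiv ℝ h x‖ ^ 2 := integral_nonneg fun x => by positivity
  have := pow_le_pow_left₀ (by positivity) key 6
  rw [mul_pow, ← Real.rpow_natCast, ← Real.rpow_mul p6, ← Real.rpow_natCast (_ ^ _) 6,
    ← Real.rpow_mul p2] at this
  norm_num at this
  exact_mod_cast this

lemma sq_norm_le_sum_sq (L : V3 →L[ℝ] ℝ) : ‖L‖ ^ 2 ≤ 3 * ∑ j, L (Pi.single j 1) ^ 2 := by
  have h1 : ‖L‖ ≤ ∑ j, |L (Pi.single j 1)| := by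
    refine L.opNorm_le_bound (by positivity) fun x => ?_
    have hx : x = ∑ j, x j • (Pi.single j (1 : ℝ) : V3) := by
      ext k; simp [Pi.single_apply]
    conv_lhs => rw [hx, map_sum]
    refine (norm_sum_le _ _).trans ?_
    rw [Finset.sum_mul]
    refine Finset.sum_le_sum fun j _ => ?_
    rw [map_smul, norm_smul, mul_comm, Real.norm_eq_abs (L _)]
    exact mul_le_mul_of_nonneg_left (norm_le_pi_norm x j) (abs_nonneg _)
  calc ‖L‖ ^ 2 ≤ (∑ j, |L (Pi.single j 1)|) ^ 2 := by gcongr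
    _ ≤ 3 * ∑ j, |L (Pi.single j 1)| ^ 2 := by
      simpa using sq_sum_le_card_mul_sum_sq (s := (Finset.univ : Finset (Fin 3)))
        (f := fun j => |L (Pi.single j 1)|)
    _ = _ := by simp only [sq_abs]

lemma integral_sq_norm_fderiv_le (h : S3) :
    ∫ x, ‖fderiv ℝ h x‖ ^ 2 ≤ 3 * ∑ j, inn (dS j h) (dS j h) := by
  have e : 3 * ∑ j, inn (dS j h) (dS j h)
      = ∫ x, 3 * ∑ j, fderiv ℝ h x (Pi.single j 1) ^ 2 := by
    rw [integral_const_mul, integral_finsetSum]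
    · simp only [inn_eq, dS_apply, sq]
    · intro j _
      exact ((mulS (dS j h) (dS j h)).integrable (μ := volume)).congr
        (.of_forall fun x => by simp [mulS_apply, dS_apply, sq])
  rw [e]
  refine integral_mono_of_nonneg (.of_forall fun x => by positivity) ?_
    (.of_forall fun x => sq_norm_le_sum_sq _)
  refine Integrable.const_mul (integrable_finsetSum _ fun j _ => ?_) _
  exact ((mulS (dS j h) (dS j h)).integrable (μ := volume)).congr
    (.of_forall fun x => by simp [mulS_apply, dS_apply, sq])

lemma inn_mulS_self_le {a : S3} {M : ℝ} (ha : ∀ x, |a x| ≤ M) (b : S3) :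
    inn (mulS a b) (mulS a b) ≤ M ^ 2 * inn b b := by
  have e : M ^ 2 * inn b b = ∫ x, M ^ 2 * (b x * b x) := by
    rw [integral_const_mul, inn_eq]
  rw [e, inn_eq]
  refine integral_mono (mulS (mulS a b) (mulS a b)).integrable
    ((mulS b b).integrable.const_mul _) fun x => ?_
  have h1 : a x ^ 2 ≤ M ^ 2 := sq_le_sq' (abs_le.mp (ha x)).1 (abs_le.mp (ha x)).2
  simp only [mulS_apply]
  nlinarith [mul_le_mul_of_nonneg_right h1 (mul_self_nonneg (b x))]

lemma inn_add_self_le (a b : S3) : inn (a + b) (a + b) ≤ 2 * (inn a a + inn b b) := by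
  have := inn_self_nonneg (a - b)
  simp only [map_add, map_sub, LinearMap.add_apply, LinearMap.sub_apply] at this ⊢
  linarith

/-- Smooth compactly supported cutoffs, equal to `1` at the origin, at scale `R`. -/
lemma exists_cutoff : ∃ M : ℝ, ∃ χ : ℝ → S3, (∀ R > 0, HasCompactSupport (χ R)) ∧
    (∀ R > 0, ∀ x, |χ R x| ≤ 1) ∧ (∀ R > 0, ∀ j x, |dS j (χ R) x| ≤ M / R) ∧
    ∀ x, Filter.Tendsto (fun R => χ R x) Filter.atTop (𝓝 1) := by
  let b : ContDiffBump (0 : V3) := ⟨1, 2, by norm_num, by norm_num⟩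
  let f : S3 := b.hasCompactSupport.toSchwartzMap b.contDiff
  have hf : ∀ x, f x = b x := fun x => rfl
  let s : ℝ → V3 ≃L[ℝ] V3 := fun R =>
    if h : R = 0 then ContinuousLinearEquiv.refl ℝ V3 else
      ContinuousLinearEquiv.smulLeft (Units.mk0 R⁻¹ (inv_ne_zero h))
  have hs : ∀ R > 0, ∀ x, s R x = R⁻¹ • x := by
    intro R hR x
    simp only [s, hR.ne', dif_neg, not_false_eq_true]
    rfl
  refine ⟨∑ j, SchwartzMap.seminorm ℝ 0 0 (dS j f),
    fun R => compCLMOfContinuousLinearEquiv ℝ (s R) f, ?_, ?_, ?_, ?_⟩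
  · intro R hR
    exact b.hasCompactSupport.comp_homeomorph (s R).toHomeomorph
  · intro R hR x
    change |b _| ≤ 1
    rw [abs_of_nonneg b.nonneg]
    exact b.le_one
  · intro R hR j x
    have : dS j (compCLMOfContinuousLinearEquiv ℝ (s R) f) x = R⁻¹ * dS j f (s R x) := by
      change (∂_{(Pi.single j 1 : V3)} (compCLMOfContinuousLinearEquiv ℝ (s R) f)) x = _
      rw [lineDerivOp_compCLMOfContinuousLinearEquiv, hs R hR, lineDerivOp_left_smul]
      rfl
    rw [this, abs_mul, abs_of_pos (inv_pos.2 hR), div_eq_inv_mul]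
    refine mul_le_mul_of_nonneg_left ?_ (inv_pos.2 hR).le
    exact (norm_le_seminorm ℝ (dS j f) (s R x)).trans
      (Finset.single_le_sum (f := fun j => SchwartzMap.seminorm ℝ 0 0 (dS j f))
        (fun _ _ => apply_nonneg _ _) (Finset.mem_univ j))
  · intro x
    have h1 : Filter.Tendsto (fun R : ℝ => b (R⁻¹ • x)) Filter.atTop (𝓝 (b ((0 : ℝ) • x))) :=
      (b.continuous.tendsto _).comp (tendsto_inv_atTop_zero.smul_const x)
    have h2 : b ((0 : ℝ) • x) = 1 := by
      rw [zero_smul]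
      exact b.one_of_mem_closedBall (Metric.mem_closedBall_self zero_le_one)
    rw [h2] at h1
    refine h1.congr' ?_
    filter_upwards [Filter.eventually_gt_atTop 0] with R hR
    change b _ = b _
    rw [← hs R hR]
    rfl

/-- Ladyzhenskaya's inequality, with the `H¹_α` norm on the right. -/
lemma exists_inn_sq_sq_le : ∃ K : ℝ, 0 < K ∧ ∀ α > 0, ∀ g : S3,
    inn (mulS g g) (mulS g g) ≤ K * α⁻¹ ^ 3 * inn g (helmS α g) ^ 2 := by
  obtain ⟨C, hC, hS⟩ := exists_integral_pow_six_le
  obtain ⟨M, χ, hsupp, h1, hd, hlim⟩ := exists_cutoff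
  set D : ℝ := 3 * (2 * (3 * M ^ 2 + 1))
  have hD : 0 < D := by positivity
  refine ⟨Real.sqrt (C * D ^ 3) + 1, by positivity, fun α hα g => ?_⟩
  set E := inn g (helmS α g) with hE
  have hE0 : 0 ≤ E := inn_helmS_self_nonneg α g
  have hEe := inn_helmS α g g
  rw [← hE] at hEe
  set G := ∑ j, inn (dS j g) (dS j g) with hG
  have hG0 : 0 ≤ G := Finset.sum_nonneg fun j _ => inn_self_nonneg _
  have hg0 := inn_self_nonneg g
  have hgE : inn g g ≤ E := by nlinarith [mul_nonneg (sq_nonneg α) hG0]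
  have main : ∀ R ≥ α, inn (mulS (mulS (χ R) g) (mulS (χ R) g))
      (mulS (mulS (χ R) g) (mulS (χ R) g)) ≤ (Real.sqrt (C * D ^ 3) + 1) * α⁻¹ ^ 3 * E ^ 2 := by
    intro R hR
    have hR0 : 0 < R := hα.trans_le hR
    set h := mulS (χ R) g with hh
    have hc : HasCompactSupport h := (hsupp R hR0).mul_right
    have b0 : inn h h ≤ E := by
      have := inn_mulS_self_le (h1 R hR0) g
      rw [← hh] at this; linarith
    have bj : ∀ j, inn (dS j h) (dS j h) ≤ 2 * ((M / R) ^ 2 * inn g g + inn (dS j g) (dS j g)) := by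
      intro j
      rw [hh, dS_mulS]
      refine (inn_add_self_le _ _).trans ?_
      have a1 := inn_mulS_self_le (hd R hR0 j) g
      have a2 := inn_mulS_self_le (h1 R hR0) (dS j g)
      linarith
    have bs : 3 * ∑ j, inn (dS j h) (dS j h) ≤ D * (α⁻¹ ^ 2 * E) := by
      have hsum := Finset.sum_le_sum fun j (_ : j ∈ Finset.univ) => bj j
      rw [← Finset.mul_sum, Finset.sum_add_distrib, ← hG] at hsum
      simp only [Finset.sum_const, Finset.card_univ, Fintype.card_fin, nsmul_eq_mul] at hsum
      have hMR : (M / R) ^ 2 ≤ M ^ 2 * α⁻¹ ^ 2 := by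
        rw [div_eq_mul_inv, mul_pow]
        gcongr
      have hGE : G ≤ α⁻¹ ^ 2 * E := by
        rw [inv_pow, ← div_eq_inv_mul, le_div_iff₀ (by positivity)]; linarith
      have : (M / R) ^ 2 * inn g g ≤ M ^ 2 * α⁻¹ ^ 2 * E := by gcongr
      simp only [D]
      push_cast at hsum
      linarith
    have c6 : inn (mulS h (mulS h h)) (mulS h (mulS h h)) ≤ C * (D * (α⁻¹ ^ 2 * E)) ^ 3 := by
      have e : inn (mulS h (mulS h h)) (mulS h (mulS h h)) = ∫ x, h x ^ 6 := by
        rw [inn_eq]; simp only [mulS_apply]; congr 1; ext x; ring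
      rw [e]
      refine (hS h hc).trans ?_
      have := (integral_sq_norm_fderiv_le h).trans bs
      have p2 : 0 ≤ ∫ x, ‖fderiv ℝ h x‖ ^ 2 := integral_nonneg fun x => by positivity
      gcongr
    have cs : inn (mulS h h) (mulS h h) ^ 2 ≤ E * (C * (D * (α⁻¹ ^ 2 * E)) ^ 3) := by
      rw [inn_mulS_left]
      refine (inn_sq_le _ _).trans ?_
      have := inn_self_nonneg (mulS h (mulS h h))
      gcongr
    have fin : inn (mulS h h) (mulS h h) ≤ Real.sqrt (C * D ^ 3) * α⁻¹ ^ 3 * E ^ 2 := by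
      refine (sq_le_sq₀ (inn_self_nonneg _) (by positivity)).1 ?_
      rw [mul_pow, mul_pow, Real.sq_sqrt (by positivity)]
      refine cs.trans (le_of_eq ?_)
      ring
    refine fin.trans ?_
    gcongr
    linarith
  have lim : Filter.Tendsto (fun R => inn (mulS (mulS (χ R) g) (mulS (χ R) g))
      (mulS (mulS (χ R) g) (mulS (χ R) g))) Filter.atTop (𝓝 (inn (mulS g g) (mulS g g))) := by
    simp only [inn_eq_integral_mulS]
    refine tendsto_integral_filter_of_dominated_convergence
      (fun x => mulS (mulS g g) (mulS g g) x) (.of_forall fun R =>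
        (SchwartzMap.continuous _).aestronglyMeasurable) ?_
      (SchwartzMap.integrable _) (.of_forall fun x => ?_)
    · filter_upwards [Filter.eventually_gt_atTop 0] with R hR
      refine .of_forall fun x => ?_
      have e : mulS (mulS (mulS (χ R) g) (mulS (χ R) g)) (mulS (mulS (χ R) g) (mulS (χ R) g)) x
          = χ R x ^ 4 * g x ^ 4 := by simp only [mulS_apply]; ring
      have e2 : mulS (mulS g g) (mulS g g) x = g x ^ 4 := by simp only [mulS_apply]; ring
      rw [e, e2, norm_mul, norm_pow, norm_pow, Real.norm_eq_abs, Real.norm_eq_abs,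
        Even.pow_abs (by decide : Even 4) (g x)]
      exact mul_le_of_le_one_left (by positivity) (pow_le_one₀ (abs_nonneg _) (h1 R hR x))
    · have := ((((hlim x).mul_const (g x)).mul ((hlim x).mul_const (g x))).mul
        (((hlim x).mul_const (g x)).mul ((hlim x).mul_const (g x))))
      simpa only [one_mul, mulS_apply] using this
  exact le_of_tendsto lim (Filter.eventually_ge_atTop α |>.mono main)

/-- Estimate of the trilinear form by the `H¹_α` energies. -/
lemma exists_abs_sum_inn_conv_le : ∃ K : ℝ, 0 < K ∧ ∀ α > 0, ∀ w u : Fin 3 → S3,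
    |∑ i, inn (conv w u i) (w i)| ≤ 9 * Real.sqrt (K * α⁻¹ ^ 5 * energy α u) * energy α w := by
  obtain ⟨K, hK, hL⟩ := exists_inn_sq_sq_le
  refine ⟨K, hK, fun α hα w u => ?_⟩
  set E := energy α w with hE
  set Q := energy α u with hQ
  have hE0 : 0 ≤ E := energy_nonneg α w
  have hQ0 : 0 ≤ Q := energy_nonneg α u
  have h4 : ∀ i, inn (mulS (w i) (w i)) (mulS (w i) (w i)) ≤ K * α⁻¹ ^ 3 * E ^ 2 := fun i => by
    refine (hL α hα (w i)).trans ?_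
    have := inn_helmS_self_nonneg α (w i)
    have := inn_helmS_le_energy α w i
    gcongr
  have h22 : ∀ i j, inn (mulS (w i) (w j)) (mulS (w i) (w j)) ≤ K * α⁻¹ ^ 3 * E ^ 2 := by
    intro i j
    have e : inn (mulS (w i) (w j)) (mulS (w i) (w j))
        = inn (mulS (w i) (w i)) (mulS (w j) (w j)) := by
      simp only [inn_eq, mulS_apply]
      congr 1; ext x; ring
    rw [e]
    refine abs_le_of_sq_le_sq' ?_ (by positivity) |>.2
    refine (inn_sq_le _ _).trans ?_
    rw [sq]
    exact mul_le_mul (h4 i) (h4 j) (inn_self_nonneg _) (by positivity)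
  have hdu : ∀ i j, inn (dS j (u i)) (dS j (u i)) ≤ α⁻¹ ^ 2 * Q := by
    intro i j
    have h1 := inn_helmS_le_energy α u i
    rw [inn_helmS] at h1
    have h2 := Finset.single_le_sum (f := fun j => inn (dS j (u i)) (dS j (u i)))
      (fun _ _ => inn_self_nonneg _) (Finset.mem_univ j)
    have h3 := inn_self_nonneg (u i)
    have h5 := mul_le_mul_of_nonneg_left h2 (sq_nonneg α)
    rw [inv_pow, ← div_eq_inv_mul, le_div_iff₀ (by positivity)]
    linarith
  have hterm : ∀ i j, |inn (mulS (w j) (dS j (u i))) (w i)|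
      ≤ Real.sqrt (K * α⁻¹ ^ 5 * Q) * E := by
    intro i j
    have e : inn (mulS (w j) (dS j (u i))) (w i) = inn (dS j (u i)) (mulS (w i) (w j)) := by
      simp only [inn_eq, mulS_apply]
      congr 1; ext x; ring
    rw [e]
    refine abs_le_of_sq_le_sq ?_ (by positivity)
    refine (inn_sq_le _ _).trans ?_
    rw [mul_pow, Real.sq_sqrt (by positivity)]
    refine (mul_le_mul (hdu i j) (h22 i j) (inn_self_nonneg _) (by positivity)).trans (le_of_eq ?_)
    ring
  calc |∑ i, inn (conv w u i) (w i)|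
      ≤ ∑ i : Fin 3, ∑ j : Fin 3, |inn (mulS (w j) (dS j (u i))) (w i)| := by
        refine (Finset.abs_sum_le_sum_abs _ _).trans (Finset.sum_le_sum fun i _ => ?_)
        have : inn (conv w u i) (w i) = ∑ j, inn (mulS (w j) (dS j (u i))) (w i) := by
          simp [conv]
        rw [this]
        exact Finset.abs_sum_le_sum_abs _ _
    _ ≤ ∑ i : Fin 3, ∑ j : Fin 3, Real.sqrt (K * α⁻¹ ^ 5 * Q) * E :=
        Finset.sum_le_sum fun i _ => Finset.sum_le_sum fun j _ => hterm i j
    _ = _ := by simp; ring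

/-- Boundedness of a curve of Schwartz functions on every interval `[0, T]`. -/
def LocBdd (G : ℝ → S3) : Prop := ∀ T, Bornology.IsVonNBounded ℝ (G '' Icc 0 T)

lemma LocBdd.clm {G : ℝ → S3} (hG : LocBdd G) (L : S3 →L[ℝ] S3) : LocBdd (fun t => L (G t)) :=
  fun T => by
    have := (hG T).image L
    rwa [image_image] at this

lemma LocBdd.add {G H : ℝ → S3} (hG : LocBdd G) (hH : LocBdd H) :
    LocBdd (fun t => G t + H t) := fun T => by
  refine ((hG T).add (hH T)).subset ?_
  rintro _ ⟨t, ht, rfl⟩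
  exact Set.add_mem_add (mem_image_of_mem G ht) (mem_image_of_mem H ht)

lemma LocBdd.sub {G H : ℝ → S3} (hG : LocBdd G) (hH : LocBdd H) :
    LocBdd (fun t => G t - H t) := fun T => by
  refine ((hG T).sub (hH T)).subset ?_
  rintro _ ⟨t, ht, rfl⟩
  exact Set.sub_mem_sub (mem_image_of_mem G ht) (mem_image_of_mem H ht)

lemma locBdd_const (f : S3) : LocBdd (fun _ => f) := fun T => by
  refine (Bornology.isVonNBounded_singleton (𝕜 := ℝ) f).subset ?_
  rintro _ ⟨t, ht, rfl⟩
  rfl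

lemma LocBdd.seminorm {G : ℝ → S3} (hG : LocBdd G) (T : ℝ) (k n : ℕ) :
    ∃ C, ∀ t ∈ Icc 0 T, SchwartzMap.seminorm ℝ k n (G t) ≤ C := by
  obtain ⟨r, _, hr⟩ :=
    (schwartz_withSeminorms ℝ V3 ℝ).isVonNBounded_iff_seminorm_bounded.1 (hG T) (k, n)
  exact ⟨r, fun t ht => (hr _ (mem_image_of_mem G ht)).le⟩

lemma LocBdd.bounded {G : ℝ → S3} (hG : LocBdd G) (T : ℝ) :
    ∃ C, 0 ≤ C ∧ ∀ t ∈ Icc 0 T, ∀ x, |G t x| ≤ C := by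
  obtain ⟨C, hC⟩ := hG.seminorm T 0 0
  exact ⟨max C 0, le_max_right _ _, fun t ht x =>
    (norm_le_seminorm ℝ (G t) x).trans ((hC t ht).trans (le_max_left _ _))⟩

lemma LocBdd.decay {G : ℝ → S3} (hG : LocBdd G) (T : ℝ) :
    ∃ C, 0 ≤ C ∧ ∀ t ∈ Icc 0 T, ∀ x, |G t x| ≤ C * (1 + ‖x‖) ^ (-4 : ℝ) := by
  obtain ⟨C₀, hC₀⟩ := hG.seminorm T 0 0
  obtain ⟨C₄, hC₄⟩ := hG.seminorm T 4 0
  refine ⟨max (8 * (C₀ + C₄)) 0, le_max_right _ _, fun t ht x => ?_⟩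
  have h0 := (norm_le_seminorm ℝ (G t) x).trans (hC₀ t ht)
  have h4 := (norm_pow_mul_le_seminorm ℝ (G t) 4 x).trans (hC₄ t ht)
  rw [Real.norm_eq_abs] at h0 h4
  have hx := norm_nonneg x
  have e : (1 + ‖x‖) ^ (-4 : ℝ) = ((1 + ‖x‖) ^ 4)⁻¹ := by
    rw [Real.rpow_neg (by positivity)]
    norm_cast
  rw [e, ← div_eq_mul_inv, le_div_iff₀ (by positivity)]
  have hp : (1 + ‖x‖) ^ 4 ≤ 8 * (1 + ‖x‖ ^ 4) := by
    have := add_pow_le (zero_le_one) hx 4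
    norm_num at this ⊢
    linarith
  have := mul_le_mul_of_nonneg_left hp (abs_nonneg (G t x))
  exact (show _ ≤ 8 * (C₀ + C₄) by linarith).trans (le_max_left _ _)

lemma integrable_weight : Integrable (fun x : V3 => (1 + ‖x‖) ^ (-4 : ℝ)) :=
  integrable_one_add_norm (by simp; norm_num)

/-- `W` is the pointwise time derivative of the curve `g` of Schwartz functions. -/
structure IsEvol (g W : ℝ → S3) : Prop where
  deriv : ∀ t ≥ 0, ∀ x, HasDerivWithinAt (fun s => g s x) (W t x) (Ici 0) t
  bdd : LocBdd g
  bdd_deriv : LocBdd W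

lemma IsEvol.sub {g W g' W' : ℝ → S3} (h : IsEvol g W) (h' : IsEvol g' W') :
    IsEvol (fun t => g t - g' t) (fun t => W t - W' t) where
  deriv t ht x := (h.deriv t ht x).sub (h'.deriv t ht x)
  bdd := h.bdd.sub h'.bdd
  bdd_deriv := h.bdd_deriv.sub h'.bdd_deriv

lemma IsEvol.exists_lipschitz {g W : ℝ → S3} (h : IsEvol g W) (T : ℝ) :
    ∃ C, 0 ≤ C ∧ ∀ s ∈ Icc 0 T, ∀ t ∈ Icc 0 T, ∀ x,
      |g t x - g s x| ≤ C * (1 + ‖x‖) ^ (-4 : ℝ) * |t - s| := by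
  obtain ⟨C, hC, hb⟩ := h.bdd_deriv.decay T
  refine ⟨C, hC, fun s hs t ht x => ?_⟩
  exact (convex_Icc 0 T).norm_image_sub_le_of_norm_hasDerivWithin_le
    (fun r hr => (h.deriv r hr.1 x).mono Icc_subset_Ici_self) (fun r hr => hb r hr x) hs ht

lemma helmS_diff (α : ℝ) (f g : S3) :
    inn f (helmS α f) - inn g (helmS α g) = inn (f - g) (helmS α (f + g)) := by
  have := inn_helmS_symm α f g
  simp only [map_add, map_sub, LinearMap.sub_apply]
  linarith

lemma helmS_diff_le (α : ℝ) (f g : S3) :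
    inn f (helmS α f) - inn g (helmS α g) ≤ 2 * inn (f - g) (helmS α f) := by
  have h1 := inn_helmS_symm α f g
  have h2 := inn_helmS_self_nonneg α (f - g)
  simp only [map_sub, LinearMap.sub_apply] at h2 ⊢
  linarith

lemma IsEvol.continuousOn {g W : ℝ → S3} (h : IsEvol g W) (α T : ℝ) :
    ContinuousOn (fun t => inn (g t) (helmS α (g t))) (Icc 0 T) := by
  obtain ⟨C, hC, hl⟩ := h.exists_lipschitz T
  obtain ⟨B, hB, hb⟩ := (h.bdd.clm (helmS α)).bounded T
  set I := ∫ x : V3, (1 + ‖x‖) ^ (-4 : ℝ)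
  have hI : 0 ≤ I := integral_nonneg fun x => by positivity
  refine (LipschitzOnWith.of_dist_le_mul (K := ⟨C * (2 * B) * I, by positivity⟩)
    fun t ht s hs => ?_).continuousOn
  rw [Real.dist_eq, Real.dist_eq, helmS_diff, inn_eq]
  have key := norm_integral_le_of_norm_le
    (f := fun x => (g t - g s) x * helmS α (g t + g s) x)
    (integrable_weight.const_mul (C * |t - s| * (2 * B))) (.of_forall fun x => ?_)
  · rw [integral_const_mul] at key
    refine key.trans (le_of_eq ?_)
    change C * |t - s| * (2 * B) * I = C * (2 * B) * I * |t - s|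
    ring
  · rw [norm_mul, map_add]
    have h1 := hl s hs t ht x
    have h2 : |(helmS α (g t) + helmS α (g s)) x| ≤ 2 * B := by
      refine (abs_add_le _ _).trans ?_
      have := hb t ht x
      have := hb s hs x
      linarith
    refine (mul_le_mul h1 h2 (abs_nonneg _) (by positivity)).trans (le_of_eq ?_)
    ring

lemma IsEvol.tendsto_inn {g W : ℝ → S3} (h : IsEvol g W) {t : ℝ} (ht : 0 < t) (q : S3) :
    Filter.Tendsto (fun s => (t - s)⁻¹ * inn (g t - g s) q) (𝓝[<] t) (𝓝 (inn (W t) q)) := by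
  obtain ⟨C, hC, hl⟩ := h.exists_lipschitz t
  have e : ∀ s, (t - s)⁻¹ * inn (g t - g s) q
      = ∫ x, (t - s)⁻¹ * ((g t - g s) x * q x) := fun s => by
    rw [integral_const_mul, inn_eq]
  simp only [e]
  rw [inn_eq]
  refine tendsto_integral_filter_of_dominated_convergence
    (fun x => C * SchwartzMap.seminorm ℝ 0 0 q * (1 + ‖x‖) ^ (-4 : ℝ))
    (.of_forall fun s =>
      ((mulS (g t - g s) q).continuous.const_smul (t - s)⁻¹).aestronglyMeasurable) ?_
    (integrable_weight.const_mul _) (.of_forall fun x => ?_)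
  · filter_upwards [Ioo_mem_nhdsLT ht] with s hs
    refine .of_forall fun x => ?_
    have h1 := hl s ⟨hs.1.le, hs.2.le⟩ t ⟨ht.le, le_rfl⟩ x
    have h2 := norm_le_seminorm ℝ q x
    have hts : 0 < t - s := sub_pos.2 hs.2
    rw [abs_of_pos hts] at h1
    rw [norm_mul, norm_mul, Real.norm_of_nonneg (inv_pos.2 hts).le, ← div_eq_inv_mul,
      div_le_iff₀ hts]
    refine (mul_le_mul h1 h2 (norm_nonneg _) (by positivity)).trans (le_of_eq ?_)
    ring
  · have hd : HasDerivAt (fun s => g s x) (W t x) t :=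
      (h.deriv t ht.le x).hasDerivAt (Ici_mem_nhds ht)
    have hs := (hasDerivWithinAt_iff_tendsto_slope' self_notMem_Iio).1
      (hd.hasDerivWithinAt (s := Iio t))
    refine (hs.mul_const (q x)).congr fun s => ?_
    rw [slope_def_field, ← neg_sub t s, ← neg_sub (g t x), neg_div_neg_eq, div_eq_inv_mul]
    exact mul_assoc _ _ _

/-- A continuous function whose left upper Dini derivative is nonpositive does not increase. -/
lemma le_of_left_slope {e : ℝ → ℝ} {a b : ℝ} (hab : a ≤ b) (hc : ContinuousOn e (Icc a b))
    (h : ∀ t ∈ Ioc a b, ∀ r > 0, ∀ᶠ s in 𝓝[<] t, e t - e s < r * (t - s)) : e b ≤ e a := by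
  have hmaps : MapsTo (fun x => a + b - x) (Icc a b) (Icc a b) := fun x hx =>
    ⟨by linarith [hx.2], by linarith [hx.1]⟩
  have key := image_le_of_liminf_slope_right_le_deriv_boundary
    (f := fun x => - e (a + b - x)) (a := a) (b := b) (B := fun _ => - e b) (B' := fun _ => 0)
    (hc.comp (by fun_prop) hmaps).neg (by simp) continuousOn_const
    (fun x _ => hasDerivWithinAt_const _ _ _) ?_ (right_mem_Icc.2 hab)
  · simpa using key
  · intro x hx r hr
    have hev := h (a + b - x) ⟨by linarith [hx.2], by linarith [hx.1]⟩ r hr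
    have ht : Filter.Tendsto (fun z => a + b - z) (𝓝[>] x) (𝓝[<] (a + b - x)) := by
      refine tendsto_nhdsWithin_iff.2 ⟨?_, ?_⟩
      · exact ((continuous_const.sub continuous_id).tendsto x).mono_left nhdsWithin_le_nhds
      · filter_upwards [self_mem_nhdsWithin] with z hz
        exact sub_lt_sub_left (mem_Ioi.1 hz) _
    refine Filter.Eventually.frequently ?_
    filter_upwards [ht.eventually hev, self_mem_nhdsWithin] with z hz hxz
    rw [slope_def_field, div_lt_iff₀ (sub_pos.2 hxz)]
    linarith

lemma IsEvol.continuousOn_energy {w W : ℝ → Fin 3 → S3}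
    (h : ∀ i, IsEvol (fun t => w t i) (fun t => W t i)) (α T : ℝ) :
    ContinuousOn (fun t => energy α (w t)) (Icc 0 T) :=
  continuousOn_finsetSum _ fun i _ => (h i).continuousOn α T

lemma IsEvol.energy_le {w W : ℝ → Fin 3 → S3}
    (h : ∀ i, IsEvol (fun t => w t i) (fun t => W t i)) {α a b : ℝ} (ha : 0 ≤ a) (hab : a ≤ b)
    (hD : ∀ t ∈ Ioc a b, ∑ i, inn (W t i) (helmS α (w t i)) ≤ 0) :
    energy α (w b) ≤ energy α (w a) := by
  refine le_of_left_slope (e := fun t => energy α (w t)) hab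
    ((IsEvol.continuousOn_energy h α b).mono (Icc_subset_Icc_left ha)) fun t ht r hr => ?_
  have ht0 : 0 < t := ha.trans_lt ht.1
  have hlim : Filter.Tendsto
      (fun s => 2 * ∑ i, (t - s)⁻¹ * inn (w t i - w s i) (helmS α (w t i))) (𝓝[<] t)
      (𝓝 (2 * ∑ i, inn (W t i) (helmS α (w t i)))) :=
    (tendsto_finsetSum _ fun i _ => (h i).tendsto_inn ht0 _).const_mul 2
  have hlt : 2 * ∑ i, inn (W t i) (helmS α (w t i)) < r := by linarith [hD t ht]
  filter_upwards [hlim.eventually_lt_const hlt, self_mem_nhdsWithin] with s hs hst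
  have hts : 0 < t - s := sub_pos.2 hst
  rw [← Finset.mul_sum, mul_left_comm, ← div_eq_inv_mul, div_lt_iff₀ hts] at hs
  refine lt_of_le_of_lt ?_ hs
  simp only [energy, ← Finset.sum_sub_distrib]
  rw [Finset.mul_sum]
  exact Finset.sum_le_sum fun i _ => helmS_diff_le α _ _

/-- If the energy cannot grow above the level `M`, then it stays below `M`. -/
lemma IsEvol.energy_le_of_barrier {w W : ℝ → Fin 3 → S3}
    (h : ∀ i, IsEvol (fun t => w t i) (fun t => W t i)) {α M : ℝ} (h0 : energy α (w 0) ≤ M)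
    (hD : ∀ t > 0, M < energy α (w t) → ∑ i, inn (W t i) (helmS α (w t i)) ≤ 0)
    {t : ℝ} (ht : 0 ≤ t) : energy α (w t) ≤ M := by
  by_contra! hM
  set S := Icc 0 t ∩ (fun s => energy α (w s)) ⁻¹' Iic M
  have hS : IsCompact S := isCompact_Icc.of_isClosed_subset
    ((IsEvol.continuousOn_energy h α t).preimage_isClosed_of_isClosed isClosed_Icc isClosed_Iic)
    inter_subset_left
  obtain ⟨a, haS, ha⟩ := hS.exists_isGreatest ⟨0, ⟨le_rfl, ht⟩, h0⟩
  refine hM.not_ge ((IsEvol.energy_le h haS.1.1 haS.1.2 fun s hs => ?_).trans haS.2)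
  refine hD s (haS.1.1.trans_lt hs.1) ?_
  by_contra! hs'
  exact hs.1.not_ge (ha ⟨⟨haS.1.1.trans hs.1.le, hs.2⟩, hs'⟩)

lemma pd_family (j : Fin 3) (w : Fin 3 → S3) :
    pd j (fun x i => w i x) = fun x i => dS j (w i) x := by
  ext x i
  have h : HasFDerivAt (fun x i => w i x) (ContinuousLinearMap.pi fun i => fderiv ℝ (w i) x) x :=
    hasFDerivAt_pi.2 fun i => (w i).hasFDerivAt x
  rw [pd, h.fderiv]
  rfl

lemma H1aSq_family (α : ℝ) (w : Fin 3 → S3) :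
    H1aSq α (fun x i => w i x) = energy α w := by
  have hint : ∀ f : S3, Integrable (fun x => f x ^ 2) := fun f => by
    simpa only [funext (mulS_apply f f), ← sq] using (mulS f f).integrable (μ := volume)
  have hinn : ∀ f : S3, ∫ x, f x ^ 2 = inn f f := fun f => by simp only [inn_eq, sq]
  have h1 : L2sq (fun x i => w i x) = ∑ i, inn (w i) (w i) := by
    rw [L2sq, integral_finsetSum _ fun i _ => hint (w i)]
    simp only [hinn]
  have h2 : H1sq (fun x i => w i x) = ∑ i, ∑ j, inn (dS j (w i)) (dS j (w i)) := by
    simp only [H1sq, pd_family]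
    rw [integral_finsetSum _ fun i _ => integrable_finsetSum _ fun j _ => hint _]
    refine Finset.sum_congr rfl fun i _ => ?_
    rw [integral_finsetSum _ fun j _ => hint _]
    simp only [hinn]
  rw [H1aSq, h1, h2, Finset.mul_sum, ← Finset.sum_add_distrib]
  simp only [energy, inn_helmS]

/-- The `i`-th component of a Schwartz vector field. -/
def compS (i : Fin 3) : SchwartzMap V3 (Fin 3 → ℝ) →L[ℝ] S3 :=
  postcompCLM (ContinuousLinearMap.proj (R := ℝ) (φ := fun _ : Fin 3 => ℝ) i)

lemma SchwartzLocBdd.exists_schwartzMap {F : Type*} [NormedAddCommGroup F] [NormedSpace ℝ F]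
    {g : ℝ → V3 → F} (hg : SchwartzLocBdd g) : ∃ G : ℝ → SchwartzMap V3 F,
      (∀ t ≥ 0, ∀ x, G t x = g t x) ∧ ∀ T, Bornology.IsVonNBounded ℝ (G '' Icc 0 T) := by
  have hsm : ∀ t ≥ 0, ContDiff ℝ ∞ (g t) := fun t ht =>
    contDiffOn_univ.1 (hg.1.comp (f := fun x : V3 => (t, x))
      (contDiff_const.prodMk contDiff_id).contDiffOn fun x _ => ⟨ht, mem_univ _⟩)
  have hdec : ∀ t ≥ 0, ∀ k n : ℕ, ∃ C : ℝ, ∀ x, ‖x‖ ^ k * ‖iteratedFDeriv ℝ n (g t) x‖ ≤ C := by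
    intro t ht k n
    obtain ⟨C, hC⟩ := hg.2 (t + 1) (by linarith) k n
    exact ⟨C, hC t ⟨ht, by linarith⟩⟩
  let G : ℝ → SchwartzMap V3 F := fun t =>
    if ht : 0 ≤ t then ⟨g t, hsm t ht, hdec t ht⟩ else 0
  have hG : ∀ t ≥ 0, ⇑(G t) = g t := fun t ht => by
    simp only [G, dif_pos (show 0 ≤ t from ht)]
    rfl
  refine ⟨G, fun t ht x => by rw [hG t ht], fun T => ?_⟩
  refine (schwartz_withSeminorms ℝ V3 F).isVonNBounded_iff_seminorm_bounded.2 fun ⟨k, n⟩ => ?_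
  obtain ⟨C, hC⟩ := hg.2 (max T 1) (by positivity) k n
  refine ⟨max C 0 + 1, by positivity, ?_⟩
  rintro _ ⟨t, ht, rfl⟩
  refine lt_of_le_of_lt (SchwartzMap.seminorm_le_bound ℝ k n (G t) (le_max_right C 0)
    fun x => ?_) (lt_add_one _)
  rw [hG t ht.1]
  exact (hC t ⟨ht.1, ht.2.trans (le_max_left _ _)⟩ x).trans (le_max_left _ _)

lemma SchwartzLocBdd.hasDerivWithinAt {u : ℝ → V3 → Fin 3 → ℝ} (hu : SchwartzLocBdd u)
    {t : ℝ} (ht : 0 ≤ t) (x : V3) (i : Fin 3) :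
    HasDerivWithinAt (fun s => u s x i) (derivWithin (fun s => u s x i) (Ici 0) t) (Ici 0) t := by
  have h1 : ContDiffOn ℝ ∞ (fun s => u s x) (Ici 0) :=
    hu.1.comp (f := fun s : ℝ => (s, x)) (contDiff_id.prodMk contDiff_const).contDiffOn
      fun s hs => ⟨hs, mem_univ _⟩
  have h2 : DifferentiableWithinAt ℝ (fun s => u s x) (Ici 0) t :=
    h1.differentiableOn (by simp) t ht
  exact (differentiableWithinAt_pi.1 h2 i).hasDerivWithinAt

lemma ClassicalSolution.exists_schwartzMap {α β ν : ℝ} {u₀ f : V3 → Fin 3 → ℝ}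
    (sol : ClassicalSolution α β ν u₀ f) {F : Fin 3 → S3} (hF : ∀ x i, f x i = F i x) :
    ∃ (U N : ℝ → Fin 3 → S3) (P : ℝ → S3),
      (∀ t ≥ 0, sol.u t = fun x i => U t i x) ∧
      (∀ t ≥ 0, ∑ j, dS j (U t j) = 0) ∧
      (∀ t ≥ 0, ∀ i, helmS α (N t i) = conv (U t) (U t) i) ∧
      ∀ i, IsEvol (fun t => U t i) (fun t => evol β ν (U t) (N t) F (P t) i) := by
  obtain ⟨U', hU', hUb⟩ := sol.reg_u.exists_schwartzMap
  obtain ⟨N', hN', hNb⟩ := sol.reg_N.exists_schwartzMap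
  obtain ⟨P, hP, hPb⟩ := sol.reg_p.exists_schwartzMap
  set U : ℝ → Fin 3 → S3 := fun t i => compS i (U' t)
  set N : ℝ → Fin 3 → S3 := fun t i => compS i (N' t)
  have hU : ∀ t ≥ 0, sol.u t = fun x i => U t i x := fun t ht => by
    ext x i; rw [← hU' t ht x]; rfl
  have hN : ∀ t ≥ 0, sol.N t = fun x i => N t i x := fun t ht => by
    ext x i; rw [← hN' t ht x]; rfl
  have hpU : ∀ t ≥ 0, ∀ j, pd j (sol.u t) = fun x i => dS j (U t i) x := fun t ht j => by
    rw [hU t ht, pd_family]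
  have hppU : ∀ t ≥ 0, ∀ j, pd j (pd j (sol.u t)) = fun x i => dS j (dS j (U t i)) x :=
    fun t ht j => by rw [hpU t ht, pd_family]
  have hppN : ∀ t ≥ 0, ∀ j, pd j (pd j (sol.N t)) = fun x i => dS j (dS j (N t i)) x :=
    fun t ht j => by rw [hN t ht, pd_family, pd_family]
  have hpP : ∀ t ≥ 0, ∀ j x, pdS j (sol.p t) x = dS j (P t) x := fun t ht j x => by
    have : sol.p t = P t := funext fun y => (hP t ht y).symm
    rw [this]; rfl
  have hUl : ∀ i, LocBdd fun t => U t i := fun i T => by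
    have := (hUb T).image (compS i)
    rwa [image_image] at this
  have hNl : ∀ i, LocBdd fun t => N t i := fun i T => by
    have := (hNb T).image (compS i)
    rwa [image_image] at this
  refine ⟨U, N, P, hU, fun t ht => ?_, fun t ht i => ?_, fun i => ⟨fun t ht x => ?_, hUl i, ?_⟩⟩
  · ext x
    have := sol.divFree t ht x
    simp only [hpU t ht] at this
    simpa using this
  · ext x
    have := sol.filter t ht x i
    simp only [hppN t ht, hpU t ht] at this
    simp only [hU t ht, hN t ht] at this
    simp only [helmS_apply, lapS_apply, conv, sub_apply, smul_apply, sum_apply, smul_eq_mul,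
      mulS_apply]
    linarith
  · have hm := sol.momentum t ht x i
    have hd := sol.reg_u.hasDerivWithinAt ht x i
    simp only [hppU t ht, hpP t ht] at hm
    simp only [hU t ht, hN t ht, hF] at hm
    have he : derivWithin (fun s => sol.u s x i) (Ici 0) t
        = evol β ν (U t) (N t) F (P t) i x := by
      simp only [evol, lapS_apply, add_apply, sub_apply, neg_apply, smul_apply, sum_apply,
        smul_eq_mul]
      linarith
    rw [he] at hd
    exact hd.congr (fun s hs => by rw [hU s hs]) (by rw [hU t ht])
  · have h1 := (hNl i).clm (-ContinuousLinearMap.id ℝ S3)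
    have h2 := (hUl i).clm (ν • lapS)
    have h3 := LocBdd.clm (G := P) hPb (dS i)
    have h4 := (hUl i).clm (β • ContinuousLinearMap.id ℝ S3)
    exact (((h1.add h2).sub h3).add (locBdd_const (F i))).sub h4

lemma IsForce.exists_schwartzMap {f : V3 → Fin 3 → ℝ} (hf : IsForce f) :
    ∃ F : Fin 3 → S3, ∀ x i, f x i = F i x := by
  let f' : SchwartzMap V3 (Fin 3 → ℝ) := ⟨f, hf.1.1, hf.1.2⟩
  exact ⟨fun i => compS i f', fun x i => rfl⟩

/-- Weighted Young inequality for the `H¹_α` inner product. -/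
lemma two_mul_sum_inn_le {α β : ℝ} (hβ : 0 < β) (F w : Fin 3 → S3) :
    2 * ∑ i, inn (F i) (helmS α (w i)) ≤ β * energy α w + energy α F / β := by
  have h : ∀ i, 2 * inn (F i) (helmS α (w i))
      ≤ β * inn (w i) (helmS α (w i)) + inn (F i) (helmS α (F i)) / β := by
    intro i
    have h1 := inn_helmS_self_nonneg α (β • w i - F i)
    have h2 := inn_helmS_symm α (F i) (w i)
    simp only [map_sub, map_smul, LinearMap.sub_apply, LinearMap.smul_apply, smul_eq_mul] at h1
    rw [← sub_le_iff_le_add', le_div_iff₀ hβ]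
    nlinarith
  simp only [energy, Finset.mul_sum, Finset.sum_div, ← Finset.sum_add_distrib]
  exact Finset.sum_le_sum fun i _ => h i

/-- The absorbing ball of radius `√8 ‖f‖ / β` is forward invariant. -/
lemma energy_le_of_absorbing {α β ν : ℝ} (hβ : 0 < β) (hν : 0 < ν) {F : Fin 3 → S3}
    {U N : ℝ → Fin 3 → S3} {P : ℝ → S3} (hdiv : ∀ t ≥ 0, ∑ j, dS j (U t j) = 0)
    (hfil : ∀ t ≥ 0, ∀ i, helmS α (N t i) = conv (U t) (U t) i)
    (hev : ∀ i, IsEvol (fun t => U t i) (fun t => evol β ν (U t) (N t) F (P t) i))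
    (h0 : energy α (U 0) ≤ 8 / β ^ 2 * energy α F) {t : ℝ} (ht : 0 ≤ t) :
    energy α (U t) ≤ 8 / β ^ 2 * energy α F := by
  refine IsEvol.energy_le_of_barrier (W := fun t => evol β ν (U t) (N t) F (P t)) hev h0
    (fun s hs hM => ?_) ht
  have h1 := sum_inn_evol_le (F := F) (p := P s) (α := α) (β := β) hν.le (hdiv s hs.le)
    (hfil s hs.le)
  rw [sum_inn_conv_self (hdiv s hs.le)] at h1
  have h2 := two_mul_sum_inn_le (α := α) hβ F (U s)
  have h3 := energy_nonneg α F
  have h4 : energy α F / β ≤ β * energy α (U s) := by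
    rw [div_mul_eq_mul_div, div_lt_iff₀ (by positivity)] at hM
    rw [div_le_iff₀ hβ]
    nlinarith
  linarith

/-- Orbital stability when the damping parameter dominates the force. -/
theorem orbital_stability :
    ∃ c : ℝ, 0 < c ∧
    ∀ (α β ν : ℝ), 0 < α → 0 < β → 0 < ν →
    ∀ (f : V3 → Fin 3 → ℝ), IsForce f →
      c / (α ^ ((5:ℝ)/2) * β) * Real.sqrt (H1aSq α f) ≤ β →
    ∀ (u₀₁ u₀₂ : V3 → Fin 3 → ℝ)
      (sol₁ : ClassicalSolution α β ν u₀₁ f) (sol₂ : ClassicalSolution α β ν u₀₂ f),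
      Real.sqrt (H1aSq α u₀₁) ≤ Real.sqrt 8 / β * Real.sqrt (H1aSq α f) →
      ∀ t ≥ (0:ℝ),
        Real.sqrt (H1aSq α (fun x i => sol₁.u t x i - sol₂.u t x i))
          ≤ Real.sqrt (H1aSq α (fun x i => u₀₁ x i - u₀₂ x i)) := by
  obtain ⟨K, hK, htri⟩ := exists_abs_sum_inn_conv_le
  refine ⟨9 * Real.sqrt (K * 8), by positivity, ?_⟩
  intro α β ν hα hβ hν f hf hc u₀₁ u₀₂ sol₁ sol₂ hu t ht
  obtain ⟨F, hF⟩ := hf.exists_schwartzMap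
  obtain ⟨U, N, P, hU, hdiv, hfil, hev⟩ := sol₁.exists_schwartzMap hF
  obtain ⟨V, M, Q, hV, hdiv', hfil', hev'⟩ := sol₂.exists_schwartzMap hF
  have hu₁ : u₀₁ = fun x i => U 0 i x := by
    rw [← hU 0 le_rfl]; exact funext fun x => (sol₁.init x).symm
  have hu₂ : u₀₂ = fun x i => V 0 i x := by
    rw [← hV 0 le_rfl]; exact funext fun x => (sol₂.init x).symm
  have hfF : f = fun x i => F i x := by ext x i; exact hF x i
  have hdiff : ∀ s, H1aSq α (fun x i => U s i x - V s i x) = energy α (fun i => U s i - V s i) :=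
    fun s => H1aSq_family α (fun i => U s i - V s i)
  rw [hU t ht, hV t ht, hu₁, hu₂, hdiff, hdiff]
  rw [hu₁, hfF, H1aSq_family, H1aSq_family] at hu
  rw [hfF, H1aSq_family] at hc
  have hF0 := energy_nonneg α F
  have h0 : energy α (U 0) ≤ 8 / β ^ 2 * energy α F := by
    have := pow_le_pow_left₀ (Real.sqrt_nonneg _) hu 2
    rwa [mul_pow, div_pow, Real.sq_sqrt (energy_nonneg _ _), Real.sq_sqrt (by norm_num),
      Real.sq_sqrt hF0] at this
  have hbd : ∀ s ≥ 0, 9 * Real.sqrt (K * α⁻¹ ^ 5 * energy α (U s)) ≤ β := by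
    intro s hs
    have h1 := energy_le_of_absorbing hβ hν hdiv hfil hev h0 hs
    refine le_trans (mul_le_mul_of_nonneg_left (Real.sqrt_le_sqrt
      (mul_le_mul_of_nonneg_left h1 (by positivity))) (by norm_num)) (le_trans (le_of_eq ?_) hc)
    have e : K * α⁻¹ ^ 5 * (8 / β ^ 2 * energy α F)
        = (K * 8) * energy α F * ((α ^ ((5:ℝ)/2) * β)⁻¹) ^ 2 := by
      have : (α ^ ((5:ℝ)/2)) ^ 2 = α ^ 5 := by
        rw [← Real.rpow_natCast, ← Real.rpow_mul hα.le]
        norm_num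
      rw [inv_pow (_ * β), mul_pow, this]
      field_simp
    rw [e, Real.sqrt_mul (by positivity), Real.sqrt_sq (by positivity),
      Real.sqrt_mul (by positivity)]
    ring
  refine Real.sqrt_le_sqrt (IsEvol.energy_le (w := fun s i => U s i - V s i)
    (fun i => (hev i).sub (hev' i)) le_rfl ht fun s hs => ?_)
  have hs0 : 0 ≤ s := hs.1.le
  set w : Fin 3 → S3 := fun i => U s i - V s i with hw
  have hevol : ∀ i, evol β ν (U s) (N s) F (P s) i - evol β ν (V s) (M s) F (Q s) i
      = evol β ν w (fun i => N s i - M s i) 0 (P s - Q s) i := by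
    intro i
    simp only [evol, hw, map_sub, smul_sub, Pi.zero_apply]
    abel
  have hwdiv : ∑ j, dS j (w j) = 0 := by
    simp only [hw, map_sub, Finset.sum_sub_distrib, hdiv s hs0, hdiv' s hs0, sub_zero]
  have hwfil : ∀ i, helmS α (N s i - M s i) = conv w (U s) i + conv (V s) w i := by
    intro i
    simp only [map_sub, hfil s hs0, hfil' s hs0, conv, hw, sub_apply,
      Finset.sum_sub_distrib]
    abel
  have h1 := sum_inn_evol_le (F := 0) (p := P s - Q s) (α := α) (β := β)
    (R := fun i => conv w (U s) i + conv (V s) w i)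
    (n := fun i => N s i - M s i) hν.le hwdiv hwfil
  have h2 := sum_inn_conv_self (hdiv' s hs0) w
  have h3 := htri α hα w (U s)
  have h4 := mul_le_mul_of_nonneg_right (hbd s hs0) (energy_nonneg α w)
  have h5 := neg_abs_le (∑ i, inn (conv w (U s) i) (w i))
  simp only [map_add, LinearMap.add_apply, Finset.sum_add_distrib, h2, Pi.zero_apply, map_zero,
    LinearMap.zero_apply, Finset.sum_const_zero] at h1
  simp only [hevol]
  linarith

end
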